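/- (Theorem 1.5(ii)–(iii).) Let n ≥ 2, let β ≥ 0 be a real number, let k be a nonnegative integer, and set ς_k = k²(n + 2k) + βk(k + n − 2). Then the set of smooth functions u on the closed unit ball of ℝⁿ that satisfy Δ²u = 0 on 𝔹, ℰu = 0 on ∂𝔹, and ℰ(Δu) + β(Δu − ℰ²u) + ς_k·u = 0 on ∂𝔹 is exactly the vector space E_k = { x ↦ −2w(x) + k(|x|² − 1)w(x) : w ∈ D_k } of restrictions to the closed ball, and its dimension equals μ_k = dim D_k, the dimension of the space of harmonic homogeneous polynomials of degree k on ℝⁿ (in particular μ_0 = 1, μ_1 = n, μ_2 = (n² + n − 2)/2). -/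

import Mathlib

/-- The Euclidean Laplacian `Δf(x) = ∑ i, ∂²f/∂xᵢ²(x)`. -/
noncomputable def lap {n : ℕ} (f : EuclideanSpace ℝ (Fin n) → ℝ)
    (x : EuclideanSpace ℝ (Fin n)) : ℝ :=
  ∑ i : Fin n,
    fderiv ℝ (fun y => fderiv ℝ f y (EuclideanSpace.single i 1)) x (EuclideanSpace.single i 1)

/-- The Euler operator `ℰf(x) = ∑ i, xᵢ ∂f/∂xᵢ(x) = ⟨x, ∇f(x)⟩ = df_x(x)`. -/
noncomputable def euler {n : ℕ} (f : EuclideanSpace ℝ (Fin n) → ℝ)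
    (x : EuclideanSpace ℝ (Fin n)) : ℝ :=
  fderiv ℝ f x x

open scoped ContDiff

namespace Wentzell

/-- The algebra of smooth real functions on `ℝⁿ`. -/
def SmoothFun (n : ℕ) : Subalgebra ℝ (EuclideanSpace ℝ (Fin n) → ℝ) where
  carrier := {f | ContDiff ℝ ∞ f}
  mul_mem' {f g} hf hg := by
    change ContDiff ℝ ∞ (f * g)
    exact ContDiff.mul hf hg
  add_mem' {f g} hf hg := by
    change ContDiff ℝ ∞ (f + g)
    exact ContDiff.add hf hg
  algebraMap_mem' r := by
    change ContDiff ℝ ∞ fun _ => r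
    exact contDiff_const

namespace SmoothFun

variable {n : ℕ}

/-- The value of a smooth function at a point, as an algebra homomorphism. -/
def ev (x : EuclideanSpace ℝ (Fin n)) : SmoothFun n →ₐ[ℝ] ℝ :=
  (Pi.evalAlgHom ℝ (fun _ : EuclideanSpace ℝ (Fin n) => ℝ) x).comp (SmoothFun n).val

theorem ev_apply (x : EuclideanSpace ℝ (Fin n)) (a : SmoothFun n) : ev x a = a.1 x := rfl

theorem ext_ev {a b : SmoothFun n} (h : ∀ x, ev x a = ev x b) : a = b :=
  Subtype.ext (funext h)

theorem contDiff_coe (a : SmoothFun n) : ContDiff ℝ ∞ a.1 := a.2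

theorem continuous_ev (a : SmoothFun n) : Continuous fun x => ev x a := (contDiff_coe a).continuous

theorem differentiable_coe (a : SmoothFun n) : Differentiable ℝ a.1 :=
  (contDiff_coe a).differentiable (by simp)

theorem contDiff_fderiv_coe (a : SmoothFun n) : ContDiff ℝ ∞ (fderiv ℝ a.1) :=
  (contDiff_coe a).fderiv_right (by simp)

/-- The directional derivative along a constant vector field. -/
noncomputable def dir (e : EuclideanSpace ℝ (Fin n)) :
    Derivation ℝ (SmoothFun n) (SmoothFun n) :=
  Derivation.mk'
    { toFun := fun a => ⟨fun x => fderiv ℝ a.1 x e, (contDiff_fderiv_coe a).clm_apply contDiff_const⟩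
      map_add' := fun a b => Subtype.ext <| funext fun x => by
        change fderiv ℝ (a.1 + b.1) x e = fderiv ℝ a.1 x e + fderiv ℝ b.1 x e
        rw [fderiv_add (differentiable_coe a x) (differentiable_coe b x)]; rfl
      map_smul' := fun r a => Subtype.ext <| funext fun x => by
        change fderiv ℝ (r • a.1) x e = r * fderiv ℝ a.1 x e
        rw [fderiv_const_smul (differentiable_coe a x)]; rfl }
    fun a b => Subtype.ext <| funext fun x => by
      change fderiv ℝ (a.1 * b.1) x e = a.1 x * fderiv ℝ b.1 x e + b.1 x * fderiv ℝ a.1 x e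
      rw [fderiv_mul (differentiable_coe a x) (differentiable_coe b x)]; rfl

theorem ev_dir (e x : EuclideanSpace ℝ (Fin n)) (a : SmoothFun n) :
    ev x (dir e a) = fderiv ℝ a.1 x e := rfl

theorem ev_dir_dir (e e' x : EuclideanSpace ℝ (Fin n)) (a : SmoothFun n) :
    ev x (dir e (dir e' a)) = fderiv ℝ (fderiv ℝ a.1) x e e' := by
  change fderiv ℝ (fun y => fderiv ℝ a.1 y e') x e = _
  rw [fderiv_clm_apply ((contDiff_fderiv_coe a).differentiable (by simp) x) (by fun_prop)]
  simp

theorem dir_comm (e e' : EuclideanSpace ℝ (Fin n)) (a : SmoothFun n) :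
    dir e (dir e' a) = dir e' (dir e a) := by
  refine ext_ev fun x => ?_
  rw [ev_dir_dir, ev_dir_dir]
  exact ((contDiff_coe a).contDiffAt.isSymmSndFDerivAt
    (by simpa using WithTop.coe_le_coe.2 (le_top (a := (2 : ℕ∞))))) e e'

/-- The coordinate functions. -/
noncomputable def coord (j : Fin n) : SmoothFun n :=
  ⟨fun x => x j, by
    change ContDiff ℝ ∞ (EuclideanSpace.proj (𝕜 := ℝ) j)
    exact ContinuousLinearMap.contDiff _⟩

@[simp] theorem ev_coord (x : EuclideanSpace ℝ (Fin n)) (j : Fin n) : ev x (coord j) = x j := rfl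

/-- The partial derivatives. -/
noncomputable def partialDeriv (i : Fin n) : Derivation ℝ (SmoothFun n) (SmoothFun n) :=
  dir (EuclideanSpace.single i 1)

theorem partialDeriv_coord (i j : Fin n) :
    partialDeriv i (coord j) = if i = j then 1 else 0 := by
  refine ext_ev fun x => ?_
  rw [partialDeriv, ev_dir]
  change fderiv ℝ (EuclideanSpace.proj (𝕜 := ℝ) j) x _ = _
  rw [ContinuousLinearMap.fderiv]
  split_ifs with h
  · simp [h]
  · simp [Ne.symm h]

/-- The Euler operator on smooth functions. -/
noncomputable def eul : Derivation ℝ (SmoothFun n) (SmoothFun n) :=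
  ∑ j, coord j • partialDeriv j

theorem eul_apply (a : SmoothFun n) : eul a = ∑ j, coord j * partialDeriv j a := by
  have h := congrFun (map_sum (Derivation.coeFnAddMonoidHom (R := ℝ) (A := SmoothFun n)
    (M := SmoothFun n)) (fun j => coord j • partialDeriv j) Finset.univ) a
  rw [Finset.sum_apply] at h
  exact h

theorem fderiv_apply_eq_sum (a : SmoothFun n) (x v : EuclideanSpace ℝ (Fin n)) :
    fderiv ℝ a.1 x v = ∑ j, v j * ev x (partialDeriv j a) := by
  conv_lhs => rw [← (EuclideanSpace.basisFun (Fin n) ℝ).sum_repr v]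
  simp [partialDeriv, ev_dir]

theorem ev_eul (x : EuclideanSpace ℝ (Fin n)) (a : SmoothFun n) :
    ev x (eul a) = fderiv ℝ a.1 x x := by
  rw [eul_apply, fderiv_apply_eq_sum]; simp

theorem coe_eul (a : SmoothFun n) : (eul a).1 = euler a.1 := funext fun x => ev_eul x a

/-- The Laplacian on smooth functions. -/
noncomputable def laplace : SmoothFun n →ₗ[ℝ] SmoothFun n :=
  ∑ i, (partialDeriv i).toLinearMap ∘ₗ (partialDeriv i).toLinearMap

theorem laplace_apply (a : SmoothFun n) :
    laplace a = ∑ i, partialDeriv i (partialDeriv i a) := by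
  simp [laplace]

theorem coe_laplace (a : SmoothFun n) : (laplace a).1 = lap a.1 := by
  funext x
  change ev x (laplace a) = _
  rw [laplace_apply, map_sum]
  rfl

theorem partialDeriv_eul (i : Fin n) (a : SmoothFun n) :
    partialDeriv i (eul a) = eul (partialDeriv i a) + partialDeriv i a := by
  rw [eul_apply, eul_apply, map_sum]
  simp only [Derivation.leibniz, partialDeriv_coord, smul_eq_mul, Finset.sum_add_distrib]
  congr 1
  · exact Finset.sum_congr rfl fun j _ => by rw [partialDeriv, partialDeriv, dir_comm]
  · simp

theorem laplace_eul (a : SmoothFun n) :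
    laplace (eul a) = eul (laplace a) + (2 : ℝ) • laplace a := by
  simp only [laplace_apply, partialDeriv_eul, map_add, map_sum, Finset.sum_add_distrib]
  rw [two_smul]; abel

/-- The function `|x|² - 1`. -/
noncomputable def rho : SmoothFun n := ∑ j, coord j * coord j - 1

theorem ev_rho (x : EuclideanSpace ℝ (Fin n)) : ev x rho = ‖x‖ ^ 2 - 1 := by
  simp [rho, EuclideanSpace.norm_sq_eq, ← sq]

theorem partialDeriv_rho (i : Fin n) : partialDeriv i rho = (2 : ℝ) • coord i := by
  simp [rho, partialDeriv_coord, Finset.sum_add_distrib, two_smul]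

theorem eul_rho : eul (rho : SmoothFun n) = (2 : ℝ) • (rho + 1) := by
  simp only [eul_apply, partialDeriv_rho]
  simp [rho, Finset.smul_sum]

theorem laplace_rho_mul (a : SmoothFun n) :
    laplace (rho * a) = rho * laplace a + (4 : ℝ) • eul a + (2 * n : ℝ) • a := by
  have h : ∀ i, partialDeriv i (partialDeriv i (rho * a)) =
      rho * partialDeriv i (partialDeriv i a) + (4 : ℝ) • (coord i * partialDeriv i a) +
        (2 : ℝ) • a := fun i => by
    simp only [Derivation.leibniz, map_add, partialDeriv_rho, smul_eq_mul, Derivation.map_smul,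
      partialDeriv_coord, if_true]
    refine ext_ev fun x => ?_
    simp only [map_add, map_mul, map_smul, smul_eq_mul, map_one]
    ring
  simp only [laplace_apply, h, Finset.sum_add_distrib, ← Finset.mul_sum, ← Finset.smul_sum,
    eul_apply, Finset.sum_const, Finset.card_univ, Fintype.card_fin]
  refine ext_ev fun x => ?_
  simp only [map_add, map_mul, map_smul, smul_eq_mul, nsmul_eq_mul, map_natCast]
  ring

theorem hasDerivAt_line (a : SmoothFun n) (x e : EuclideanSpace ℝ (Fin n)) (t : ℝ) :
    HasDerivAt (fun s : ℝ => ev (x + s • e) a) (ev (x + t • e) (dir e a)) t := by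
  have h : HasDerivAt (fun s : ℝ => x + s • e) e t := by
    simpa using ((hasDerivAt_id t).smul_const e).const_add x
  exact (differentiable_coe a _).hasFDerivAt.comp_hasDerivAt t h

theorem ev_dir_dir_nonpos_of_isLocalMax {a : SmoothFun n} {x : EuclideanSpace ℝ (Fin n)}
    (h : IsLocalMax (fun y => ev y a) x) (e : EuclideanSpace ℝ (Fin n)) :
    ev x (dir e (dir e a)) ≤ 0 := by
  by_contra! hpos
  have hd : deriv (fun s : ℝ => ev (x + s • e) a) = fun s => ev (x + s • e) (dir e a) :=
    funext fun s => (hasDerivAt_line a x e s).deriv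
  have hdd : deriv (deriv fun s : ℝ => ev (x + s • e) a) 0 = ev x (dir e (dir e a)) := by
    rw [hd, (hasDerivAt_line (dir e a) x e 0).deriv]; simp
  have hmax : IsLocalMax (fun s : ℝ => ev (x + s • e) a) 0 := by
    have hc : ContinuousAt (fun s : ℝ => x + s • e) 0 := by fun_prop
    have h' : IsLocalMax (fun y => ev y a) (x + (0 : ℝ) • e) := by simpa using h
    exact hc.tendsto.eventually h'
  have hmin := isLocalMin_of_deriv_deriv_pos (hdd ▸ hpos) hmax.deriv_eq_zero
    (hasDerivAt_line a x e 0).continuousAt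
  have hconst : (fun s : ℝ => ev (x + s • e) a) =ᶠ[nhds 0] fun _ => ev (x + (0 : ℝ) • e) a := by
    filter_upwards [hmax, hmin] with s h₁ h₂ using le_antisymm h₁ h₂
  have h0 : deriv (deriv fun s : ℝ => ev (x + s • e) a) 0 = 0 := by
    rw [hconst.deriv.deriv_eq]; simp
  linarith [hdd, h0]

theorem laplace_rho : laplace (rho : SmoothFun n) = (2 * n : ℝ) • 1 := by
  have h := laplace_rho_mul (1 : SmoothFun n)
  simpa [laplace_apply] using h

/-- The maximum principle on the unit ball, for functions vanishing on the unit sphere. -/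
theorem ev_nonpos_of_laplace_eq_zero (hn : 0 < n) {a : SmoothFun n}
    (ha : ∀ x, ‖x‖ < 1 → ev x (laplace a) = 0) (hb : ∀ x, ‖x‖ = 1 → ev x a = 0)
    {x : EuclideanSpace ℝ (Fin n)} (hx : ‖x‖ ≤ 1) : ev x a ≤ 0 := by
  refine le_of_forall_pos_le_add fun ε hε => ?_
  obtain ⟨z, hz, hmax⟩ := (isCompact_closedBall (0 : EuclideanSpace ℝ (Fin n)) 1).exists_isMaxOn
    ⟨0, by simp⟩ (continuous_ev (a + ε • rho)).continuousOn
  rw [mem_closedBall_zero_iff] at hz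
  have hz1 : ‖z‖ = 1 := by
    by_contra hne
    have hlt : ‖z‖ < 1 := lt_of_le_of_ne hz hne
    have hloc : IsLocalMax (fun y => ev y (a + ε • rho)) z :=
      hmax.isLocalMax (Metric.closedBall_mem_nhds_of_mem (by simpa using hlt))
    have h1 : ev z (laplace (a + ε • rho)) ≤ 0 := by
      rw [laplace_apply, map_sum]
      exact Finset.sum_nonpos fun i _ => ev_dir_dir_nonpos_of_isLocalMax hloc _
    simp only [map_add, map_smul, laplace_rho, ha z hlt, smul_eq_mul, map_one] at h1
    have : (0 : ℝ) < n := by exact_mod_cast hn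
    have : 0 < ε * (2 * n * 1) := by positivity
    linarith
  have h2 : ev x (a + ε • rho) ≤ ev z (a + ε • rho) := hmax (by simpa using hx)
  simp only [map_add, map_smul, ev_rho, hb z hz1, hz1, smul_eq_mul] at h2
  nlinarith [norm_nonneg x, sq_nonneg ‖x‖, mul_nonneg hε.le (sq_nonneg ‖x‖)]

theorem ev_eq_zero_of_laplace_eq_zero (hn : 0 < n) {a : SmoothFun n}
    (ha : ∀ x, ‖x‖ < 1 → ev x (laplace a) = 0) (hb : ∀ x, ‖x‖ = 1 → ev x a = 0)
    {x : EuclideanSpace ℝ (Fin n)} (hx : ‖x‖ ≤ 1) : ev x a = 0 := by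
  refine le_antisymm (ev_nonpos_of_laplace_eq_zero hn ha hb hx) ?_
  have h := ev_nonpos_of_laplace_eq_zero hn (a := -a)
    (fun x hx => by simp [ha x hx]) (fun x hx => by simp [hb x hx]) hx
  simpa using h

theorem ev_eq_zero_of_norm_le {a : SmoothFun n} (ha : ∀ x, ‖x‖ < 1 → ev x a = 0)
    {x : EuclideanSpace ℝ (Fin n)} (hx : ‖x‖ ≤ 1) : ev x a = 0 := by
  have hcl : IsClosed {x | ev x a = 0} := isClosed_eq (continuous_ev a) continuous_const
  have hsub : Metric.ball (0 : EuclideanSpace ℝ (Fin n)) 1 ⊆ {x | ev x a = 0} :=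
    fun y hy => ha y (by simpa using hy)
  have h := hcl.closure_subset_iff.2 hsub
  rw [closure_ball _ one_ne_zero] at h
  exact h (by simpa using hx)

theorem ev_dir_eq_zero {a : SmoothFun n} (ha : ∀ x, ‖x‖ < 1 → ev x a = 0)
    (e : EuclideanSpace ℝ (Fin n)) {x : EuclideanSpace ℝ (Fin n)} (hx : ‖x‖ < 1) :
    ev x (dir e a) = 0 := by
  have h : a.1 =ᶠ[nhds x] fun _ => 0 := by
    filter_upwards [Metric.isOpen_ball.mem_nhds (show x ∈ Metric.ball 0 1 by simpa using hx)]
      with y hy using ha y (by simpa using hy)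
  rw [ev_dir, h.fderiv_eq]
  simp

theorem ev_eul_eq_zero {a : SmoothFun n} (ha : ∀ x, ‖x‖ < 1 → ev x a = 0)
    {x : EuclideanSpace ℝ (Fin n)} (hx : ‖x‖ < 1) : ev x (eul a) = 0 := by
  rw [ev_eul, ← ev_dir, ev_dir_eq_zero ha x hx]

theorem ev_laplace_eq_zero {a : SmoothFun n} (ha : ∀ x, ‖x‖ < 1 → ev x a = 0)
    {x : EuclideanSpace ℝ (Fin n)} (hx : ‖x‖ < 1) : ev x (laplace a) = 0 := by
  rw [laplace_apply, map_sum]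
  exact Finset.sum_eq_zero fun i _ =>
    ev_dir_eq_zero (fun y hy => ev_dir_eq_zero ha _ hy) _ hx

theorem ev_eul_eul (a : SmoothFun n) (y : EuclideanSpace ℝ (Fin n)) :
    ev y (eul (eul a)) = ev y (dir y (dir y a)) + ev y (eul a) := by
  rw [ev_eul, ev_dir_dir, ev_eul,
    show (eul a).1 = fun z => fderiv ℝ a.1 z z from funext fun z => ev_eul z a,
    fderiv_clm_apply ((contDiff_fderiv_coe a).differentiable (by simp) y) (by fun_prop)]
  simp [add_comm]

theorem ev_dir_dir_of_unit_tangent {a : SmoothFun n} (ha : ∀ x, ‖x‖ = 1 → ev x a = 0)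
    {y e : EuclideanSpace ℝ (Fin n)} (hy : ‖y‖ = 1) (he : ‖e‖ = 1) (hye : inner ℝ y e = 0) :
    ev y (dir e (dir e a)) = ev y (eul a) := by
  have hc : ∀ t : ℝ, HasDerivAt (fun t : ℝ => Real.cos t • y + Real.sin t • e)
      (-Real.sin t • y + Real.cos t • e) t := fun t =>
    ((Real.hasDerivAt_cos t).smul_const y).add ((Real.hasDerivAt_sin t).smul_const e)
  have hc' : HasDerivAt (fun t : ℝ => -Real.sin t • y + Real.cos t • e)
      (-Real.cos 0 • y + -Real.sin 0 • e) 0 :=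
    ((Real.hasDerivAt_sin 0).neg.smul_const y).add ((Real.hasDerivAt_cos 0).smul_const e)
  have hnorm : ∀ t : ℝ, ‖Real.cos t • y + Real.sin t • e‖ = 1 := fun t => by
    have h := norm_add_sq_real (Real.cos t • y) (Real.sin t • e)
    simp only [norm_smul, hy, he, real_inner_smul_left, real_inner_smul_right, hye,
      Real.norm_eq_abs, mul_one, mul_zero, add_zero, sq_abs, Real.cos_sq_add_sin_sq] at h
    exact (pow_eq_one_iff_of_nonneg (norm_nonneg _) two_ne_zero).1 h
  have hz : ∀ t : ℝ, fderiv ℝ a.1 (Real.cos t • y + Real.sin t • e)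
      (-Real.sin t • y + Real.cos t • e) = 0 := fun t => by
    have h1 := (differentiable_coe a _).hasFDerivAt.comp_hasDerivAt t (hc t)
    have h2 : (a.1 ∘ fun t : ℝ => Real.cos t • y + Real.sin t • e) = fun _ => 0 :=
      funext fun s => ha _ (hnorm s)
    rw [h2] at h1
    exact h1.unique (hasDerivAt_const t 0)
  have h1 := ((((contDiff_fderiv_coe a).differentiable (by simp) _).hasFDerivAt.comp_hasDerivAt 0
    (hc 0)).clm_apply hc').unique
    ((hasDerivAt_const (0 : ℝ) (0 : ℝ)).congr_of_eventuallyEq (Filter.Eventually.of_forall hz))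
  simp only [Function.comp, Real.cos_zero, Real.sin_zero, neg_zero, one_smul, zero_smul, add_zero,
    zero_add, neg_smul, map_neg] at h1
  rw [ev_dir_dir, ev_eul]
  linarith

theorem ev_dir_dir_of_tangent {a : SmoothFun n} (ha : ∀ x, ‖x‖ = 1 → ev x a = 0)
    {y : EuclideanSpace ℝ (Fin n)} (hy : ‖y‖ = 1) (e : EuclideanSpace ℝ (Fin n))
    (hye : inner ℝ y e = 0) : ev y (dir e (dir e a)) = ‖e‖ ^ 2 * ev y (eul a) := by
  rcases eq_or_ne e 0 with rfl | he
  · simp [ev_dir_dir]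
  have he' : ‖e‖ ≠ 0 := norm_ne_zero_iff.2 he
  have h := ev_dir_dir_of_unit_tangent ha hy (e := ‖e‖⁻¹ • e) (by simp [norm_smul, he'])
    (by rw [real_inner_smul_right, hye, mul_zero])
  rw [ev_dir_dir] at h ⊢
  simp only [map_smul, smul_apply, smul_eq_mul] at h
  rw [← h]; field_simp

/-- The radial part of the Laplacian on the unit sphere. -/
theorem ev_laplace_of_eq_zero_on_sphere {a : SmoothFun n} (ha : ∀ x, ‖x‖ = 1 → ev x a = 0)
    {y : EuclideanSpace ℝ (Fin n)} (hy : ‖y‖ = 1) :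
    ev y (laplace a) = ev y (eul (eul a)) + (n - 2) * ev y (eul a) := by
  have hsq : ∑ i, y i * y i = 1 := by
    have := EuclideanSpace.norm_sq_eq y
    simp only [hy, Real.norm_eq_abs, sq_abs] at this
    simpa [sq] using this.symm
  have key : ∀ i, ev y (partialDeriv i (partialDeriv i a)) -
      2 * (y i * ev y (partialDeriv i (dir y a))) + (y i * y i) * ev y (dir y (dir y a)) =
      (1 - y i * y i) * ev y (eul a) := fun i => by
    have h := ev_dir_dir_of_tangent ha hy (EuclideanSpace.single i 1 - y i • y)
      (by rw [inner_sub_right, real_inner_smul_right, real_inner_self_eq_norm_sq, hy]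
          simp [EuclideanSpace.inner_single_right])
    have hn : ‖EuclideanSpace.single i (1 : ℝ) - y i • y‖ ^ 2 = 1 - y i * y i := by
      rw [norm_sub_sq_real, real_inner_smul_right, norm_smul, hy]
      simp [EuclideanSpace.inner_single_left]
      ring
    rw [hn, ev_dir_dir] at h
    rw [← h, partialDeriv, ev_dir_dir, ev_dir_dir, ev_dir_dir]
    have hs := (ev_dir_dir (EuclideanSpace.single i 1) y y a).symm.trans
      ((congrArg (ev y) (dir_comm _ _ a)).trans (ev_dir_dir y (EuclideanSpace.single i 1) y a))
    simp only [map_sub, map_smul, sub_apply, smul_apply, smul_eq_mul, hs]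
    ring
  have hsum := Finset.sum_congr (rfl : (Finset.univ : Finset (Fin n)) = _) fun i _ => key i
  rw [Finset.sum_add_distrib, Finset.sum_sub_distrib, ← Finset.mul_sum, ← Finset.sum_mul,
    ← Finset.sum_mul, Finset.sum_sub_distrib, hsq] at hsum
  have h1 : ∑ i, y i * ev y (partialDeriv i (dir y a)) = ev y (dir y (dir y a)) := by
    rw [ev_dir y y (dir y a), fderiv_apply_eq_sum]
  simp only [h1, Finset.sum_const, Finset.card_univ, Fintype.card_fin, nsmul_eq_mul] at hsum
  rw [ev_eul_eul, laplace_apply, map_sum]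
  linarith

theorem ev_eq_zero_of_ev_eul_nonpos {a : SmoothFun n} (h0 : ev 0 a = 0)
    (ha : ∀ x, ‖x‖ < 1 → 0 ≤ ev x a) (hd : ∀ x, ‖x‖ < 1 → ev x (eul a) ≤ 0)
    {x : EuclideanSpace ℝ (Fin n)} (hx : ‖x‖ < 1) : ev x a = 0 := by
  refine le_antisymm ?_ (ha x hx)
  have hderiv := fun t => hasDerivAt_line a 0 x t
  simp only [zero_add] at hderiv
  have hanti : AntitoneOn (fun s : ℝ => ev (s • x) a) (Set.Icc 0 1) := by
    refine antitoneOn_of_deriv_nonpos (convex_Icc 0 1)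
      (fun t _ => (hderiv t).continuousAt.continuousWithinAt)
      (fun t _ => (hderiv t).differentiableAt.differentiableWithinAt) fun t ht => ?_
    rw [interior_Icc] at ht
    rw [(hderiv t).deriv]
    have h1 : ‖t • x‖ < 1 := by
      rw [norm_smul, Real.norm_eq_abs, abs_of_pos ht.1]
      nlinarith [norm_nonneg x, ht.1, ht.2]
    have h2 := hd _ h1
    rw [ev_eul, map_smul, smul_eq_mul] at h2
    exact nonpos_of_mul_nonpos_right h2 ht.1
  have h := hanti (Set.left_mem_Icc.2 zero_le_one) (Set.right_mem_Icc.2 zero_le_one) zero_le_one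
  simpa [h0] using h

theorem ev_congr_of_norm_le {a b : SmoothFun n} (h : ∀ x, ‖x‖ < 1 → ev x a = ev x b)
    {x : EuclideanSpace ℝ (Fin n)} (hx : ‖x‖ ≤ 1) : ev x a = ev x b := by
  have := ev_eq_zero_of_norm_le (a := a - b) (fun y hy => by simp [h y hy]) hx
  simpa [sub_eq_zero] using this

theorem ev_eul_congr {a b : SmoothFun n} (h : ∀ x, ‖x‖ < 1 → ev x a = ev x b)
    {x : EuclideanSpace ℝ (Fin n)} (hx : ‖x‖ < 1) : ev x (eul a) = ev x (eul b) := by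
  have := ev_eul_eq_zero (a := a - b) (fun y hy => by simp [h y hy]) hx
  simpa [sub_eq_zero] using this

theorem ev_laplace_congr {a b : SmoothFun n} (h : ∀ x, ‖x‖ < 1 → ev x a = ev x b)
    {x : EuclideanSpace ℝ (Fin n)} (hx : ‖x‖ < 1) : ev x (laplace a) = ev x (laplace b) := by
  have := ev_laplace_eq_zero (a := a - b) (fun y hy => by simp [h y hy]) hx
  simpa [sub_eq_zero] using this

theorem ev_laplace_eul_eq_zero {a : SmoothFun n} (h : ∀ x, ‖x‖ < 1 → ev x (laplace a) = 0)
    {x : EuclideanSpace ℝ (Fin n)} (hx : ‖x‖ < 1) : ev x (laplace (eul a)) = 0 := by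
  simp [laplace_eul, h x hx, ev_eul_eq_zero h hx]

/-- A biharmonic function with vanishing normal derivative satisfying the Wentzell condition
has the same boundary values as some harmonic function. -/
theorem exists_harmonic_of_wentzell (hn : 0 < n) {β ς : ℝ} (hβ : 0 ≤ β) {u : SmoothFun n}
    (hu : ∀ x, ‖x‖ < 1 → ev x (laplace (laplace u)) = 0)
    (hN : ∀ x, ‖x‖ = 1 → ev x (eul u) = 0)
    (hW : ∀ x, ‖x‖ = 1 → ev x (eul (laplace u)) +
      β * (ev x (laplace u) - ev x (eul (eul u))) + ς * ev x u = 0) :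
    ∃ f : SmoothFun n, (∀ x, ‖x‖ < 1 → ev x (laplace f) = 0) ∧
      (∀ x, ‖x‖ = 1 → ev x f = ev x u) ∧
      (∀ x, ‖x‖ = 1 → 4 * ev x (eul (eul u)) =
        (2 * n - 8) * ev x (eul f) + 2 * ev x (laplace u)) := by
  set F : SmoothFun n := (4 : ℝ) • eul u + (2 * n - 8 : ℝ) • u - rho * laplace u with hFdef
  have hF : ∀ x, ‖x‖ < 1 → ev x (laplace F) = 0 := fun x hx => by
    simp only [hFdef, map_add, map_sub, map_smul, map_mul, laplace_eul, laplace_rho_mul,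
      smul_eq_mul, hu x hx]
    ring
  have hFb : ∀ x, ‖x‖ = 1 → ev x F = (2 * n - 8) * ev x u := fun x hx => by
    simp only [hFdef, map_add, map_sub, map_smul, map_mul, ev_rho, smul_eq_mul, hN x hx, hx]
    ring
  have hFe : ∀ x, ‖x‖ = 1 → ev x (eul F) = 4 * ev x (eul (eul u)) - 2 * ev x (laplace u) :=
    fun x hx => by
      simp only [hFdef, map_add, map_sub, map_smul, Derivation.map_smul, Derivation.leibniz,
        eul_rho, map_mul, ev_rho, smul_eq_mul, hN x hx, hx, map_one]
      ring
  have of_extension : ∀ f : SmoothFun n, (∀ x, ‖x‖ < 1 → ev x (laplace f) = 0) →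
      (∀ x, ‖x‖ = 1 → ev x f = ev x u) →
      ∀ x, ‖x‖ = 1 → 4 * ev x (eul (eul u)) =
        (2 * n - 8) * ev x (eul f) + 2 * ev x (laplace u) := fun f hf hfu x hx => by
    have h : ∀ y, ‖y‖ < 1 → ev y F = ev y ((2 * n - 8 : ℝ) • f) := fun y hy => by
      have := ev_eq_zero_of_laplace_eq_zero hn (a := F - (2 * n - 8 : ℝ) • f)
        (fun z hz => by simp [hF z hz, hf z hz])
        (fun z hz => by simp [hFb z hz, hfu z hz]) hy.le
      simpa [sub_eq_zero] using this
    have h' := ev_congr_of_norm_le (fun y hy => ev_eul_congr h hy) hx.le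
    rw [hFe x hx] at h'
    simp only [Derivation.map_smul, map_smul, smul_eq_mul] at h'
    linarith
  suffices ∃ f : SmoothFun n, (∀ x, ‖x‖ < 1 → ev x (laplace f) = 0) ∧
      (∀ x, ‖x‖ = 1 → ev x f = ev x u) by
    obtain ⟨f, hf, hfu⟩ := this
    exact ⟨f, hf, hfu, of_extension f hf hfu⟩
  set G : SmoothFun n := eul (laplace u) + β • ((1 / 2 : ℝ) • laplace u - (1 / 4 : ℝ) • eul F)
    with hGdef
  have hG : ∀ x, ‖x‖ < 1 → ev x (laplace G) = 0 := fun x hx => by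
    simp only [hGdef, map_add, map_sub, map_smul, smul_eq_mul, hu x hx,
      ev_laplace_eul_eq_zero hu hx, ev_laplace_eul_eq_zero hF hx]
    ring
  have hGb : ∀ x, ‖x‖ = 1 → ev x G = -ς * ev x u := fun x hx => by
    simp only [hGdef, map_add, map_sub, map_smul, smul_eq_mul, hFe x hx]
    linarith [hW x hx]
  by_cases hς : ς = 0
  · by_cases h4 : (2 * n - 8 : ℝ) = 0
    · have hF0 : ∀ x, ‖x‖ < 1 → ev x F = 0 := fun x hx =>
        ev_eq_zero_of_laplace_eq_zero hn hF (fun y hy => by rw [hFb y hy, h4, zero_mul]) hx.le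
      have hG0 : ∀ x, ‖x‖ < 1 → ev x G = 0 := fun x hx =>
        ev_eq_zero_of_laplace_eq_zero hn hG (fun y hy => by rw [hGb y hy, hς]; simp) hx.le
      have hode : ∀ x, ‖x‖ < 1 → ev x (eul (laplace u)) = -(β / 2) * ev x (laplace u) :=
        fun x hx => by
          have h := hG0 x hx
          simp only [hGdef, map_add, map_sub, map_smul, smul_eq_mul, ev_eul_eq_zero hF0 hx] at h
          linarith
      have h0 : ev 0 (laplace u) = 0 := by
        have h := hF0 0 (by simp)
        simp only [hFdef, map_add, map_sub, map_smul, map_mul, smul_eq_mul, ev_rho, ev_eul,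
          h4, map_zero, norm_zero] at h
        linarith
      refine ⟨u, fun x hx => ?_, fun _ _ => rfl⟩
      have h := ev_eq_zero_of_ev_eul_nonpos (a := laplace u * laplace u) (by simp [h0])
        (fun y _ => by rw [map_mul]; exact mul_self_nonneg _)
        (fun y hy => by
          simp only [Derivation.leibniz, map_add, smul_eq_mul, map_mul, hode y hy]
          nlinarith [mul_nonneg hβ (mul_self_nonneg (ev y (laplace u)))]) hx
      simpa using h
    · exact ⟨(2 * n - 8 : ℝ)⁻¹ • F, fun x hx => by simp [hF x hx], fun x hx => by
        rw [map_smul, hFb x hx, smul_eq_mul, inv_mul_cancel_left₀ h4]⟩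
  · exact ⟨(-ς)⁻¹ • G, fun x hx => by simp [hG x hx], fun x hx => by
      rw [map_smul, hGb x hx, smul_eq_mul, inv_mul_cancel_left₀ (neg_ne_zero.2 hς)]⟩

/-- Every solution of the Wentzell problem comes from a harmonic function satisfying a cubic
equation in the Euler operator. -/
theorem exists_harmonic_cubic_of_wentzell (hn : 0 < n) {β ς : ℝ} (hβ : 0 ≤ β) {u : SmoothFun n}
    (hu : ∀ x, ‖x‖ < 1 → ev x (laplace (laplace u)) = 0)
    (hN : ∀ x, ‖x‖ = 1 → ev x (eul u) = 0)
    (hW : ∀ x, ‖x‖ = 1 → ev x (eul (laplace u)) +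
      β * (ev x (laplace u) - ev x (eul (eul u))) + ς * ev x u = 0) :
    ∃ f : SmoothFun n, (∀ x, ‖x‖ < 1 → ev x (laplace f) = 0) ∧
      (∀ x, ‖x‖ < 1 → 2 * ev x (eul (eul (eul f))) + (n + β) * ev x (eul (eul f)) +
        β * (n - 2) * ev x (eul f) = ς * ev x f) ∧
      (∀ x, ‖x‖ ≤ 1 → ev x u = ev x f - 1 / 2 * (‖x‖ ^ 2 - 1) * ev x (eul f)) := by
  obtain ⟨f, hf, hfu, hee⟩ := exists_harmonic_of_wentzell hn hβ hu hN hW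
  have hf1 : ∀ x, ‖x‖ < 1 → ev x (laplace (eul f)) = 0 := fun x hx => ev_laplace_eul_eq_zero hf hx
  have hf2 : ∀ x, ‖x‖ < 1 → ev x (laplace (eul (eul f))) = 0 :=
    fun x hx => ev_laplace_eul_eq_zero hf1 hx
  have hf3 : ∀ x, ‖x‖ < 1 → ev x (laplace (eul (eul (eul f)))) = 0 :=
    fun x hx => ev_laplace_eul_eq_zero hf2 hx
  have hlapb : ∀ x, ‖x‖ = 1 → ev x (laplace u) =
      -2 * ev x (eul (eul f)) - n * ev x (eul f) := fun x hx => by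
    have h := ev_laplace_of_eq_zero_on_sphere (a := u - f) (fun y hy => by simp [hfu y hy]) hx
    have hfx : ev x (laplace f) = 0 := ev_eq_zero_of_norm_le hf hx.le
    simp only [map_sub, hfx, hN x hx] at h
    linarith [hee x hx]
  have hlap : ∀ x, ‖x‖ < 1 → ev x (laplace u) =
      ev x ((-2 : ℝ) • eul (eul f) - (n : ℝ) • eul f) := fun x hx => by
    have h := ev_eq_zero_of_laplace_eq_zero hn
      (a := laplace u - ((-2 : ℝ) • eul (eul f) - (n : ℝ) • eul f))
      (fun y hy => by simp [hu y hy, hf1 y hy, hf2 y hy])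
      (fun y hy => by simp [hlapb y hy]) hx.le
    simpa [sub_eq_zero] using h
  refine ⟨f, hf, fun x hx => ?_, fun x hx => ?_⟩
  · have h := ev_eq_zero_of_laplace_eq_zero hn
      (a := (2 : ℝ) • eul (eul (eul f)) + (n + β) • eul (eul f) + (β * (n - 2)) • eul f - ς • f)
      (fun y hy => by simp [hf y hy, hf1 y hy, hf2 y hy, hf3 y hy])
      (fun y hy => by
        have h1 := ev_congr_of_norm_le (fun y hy => ev_eul_congr hlap hy) hy.le
        have h2 := hee y hy
        have h3 := hW y hy
        have h4 := hlapb y hy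
        simp only [map_add, map_sub, map_smul, Derivation.map_smul, smul_eq_mul] at h1 ⊢
        rw [hfu y hy]
        rw [show ev y (eul (eul u)) = ((2 * n - 8) * ev y (eul f) + 2 * ev y (laplace u)) / 4 by
          linarith, h1, h4] at h3
        linarith) hx.le
    simp only [map_add, map_sub, map_smul, smul_eq_mul] at h
    linarith
  · have h := ev_eq_zero_of_laplace_eq_zero hn
      (a := u - f + (1 / 2 : ℝ) • (rho * eul f))
      (fun y hy => by
        have h1 := hlap y hy
        simp only [map_sub, map_smul, smul_eq_mul] at h1
        simp only [map_add, map_sub, map_smul, map_mul, smul_eq_mul, laplace_rho_mul, hf y hy,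
          hf1 y hy, h1]
        ring)
      (fun y hy => by simp [hfu y hy, ev_rho, hy]) hx
    simp only [map_add, map_sub, map_smul, map_mul, smul_eq_mul, ev_rho] at h
    linarith

theorem ev_eul_eq_of_cubic (hn : 2 ≤ n) {β : ℝ} (hβ : 0 ≤ β) (k : ℕ) {f : SmoothFun n}
    (hf : ∀ x, ‖x‖ < 1 → 2 * ev x (eul (eul (eul f))) + (n + β) * ev x (eul (eul f)) +
      β * (n - 2) * ev x (eul f) =
      ((k : ℝ) ^ 2 * (n + 2 * k) + β * k * (k + n - 2)) * ev x f)
    {x : EuclideanSpace ℝ (Fin n)} (hx : ‖x‖ < 1) : ev x (eul f) = k * ev x f := by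
  have hn' : (2 : ℝ) ≤ n := by exact_mod_cast hn
  have hk : (0 : ℝ) ≤ k := k.cast_nonneg
  set b : ℝ := 2 * k + n + β with hb
  set c : ℝ := 2 * k ^ 2 + (n + β) * k + β * (n - 2) with hc
  have hb0 : 0 < b := by positivity
  have hc0 : 0 ≤ c := by
    have := mul_nonneg hβ (sub_nonneg.2 hn')
    positivity
  set p : SmoothFun n := eul f - (k : ℝ) • f with hp
  have hode : ∀ y, ‖y‖ < 1 → 2 * ev y (eul (eul p)) + b * ev y (eul p) + c * ev y p = 0 :=
    fun y hy => by
      simp only [hp, hb, hc, map_sub, map_smul, Derivation.map_smul, smul_eq_mul]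
      linarith [hf y hy]
  have heul0 : ∀ a : SmoothFun n, ev 0 (eul a) = 0 := fun a => by rw [ev_eul, map_zero]
  have hcp : c * ev 0 p = 0 := by
    have := hode 0 (by simp)
    rw [heul0, heul0] at this
    linarith
  have henergy : ∀ y, ‖y‖ < 1 → ev y (eul p * eul p + (c / 2) • (p * p)) = 0 := fun y hy => by
    refine ev_eq_zero_of_ev_eul_nonpos ?_ (fun z _ => ?_) (fun z hz => ?_) hy
    · simp only [map_add, map_mul, map_smul, smul_eq_mul, heul0]
      linear_combination ev 0 p / 2 * hcp
    · simp only [map_add, map_mul, map_smul, smul_eq_mul]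
      have := mul_self_nonneg (ev z (eul p))
      have := mul_nonneg hc0 (mul_self_nonneg (ev z p))
      linarith
    · simp only [map_add, map_mul, map_smul, Derivation.map_smul, Derivation.leibniz, smul_eq_mul]
      have := mul_nonneg hb0.le (mul_self_nonneg (ev z (eul p)))
      have h : ev z (eul p) * (2 * ev z (eul (eul p)) + b * ev z (eul p) + c * ev z p) = 0 := by
        rw [hode z hz, mul_zero]
      linarith
  have heulp : ∀ y, ‖y‖ < 1 → ev y (eul p) = 0 := fun y hy => by
    have h := henergy y hy
    simp only [map_add, map_mul, map_smul, smul_eq_mul] at h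
    have h1 := mul_nonneg hc0 (mul_self_nonneg (ev y p))
    have h2 := mul_self_nonneg (ev y (eul p))
    exact mul_self_eq_zero.1 (by linarith)
  have hp0 : ev 0 p = 0 := by
    rcases Nat.eq_zero_or_pos k with h | h
    · simp [hp, h, heul0]
    · have hk' : (0 : ℝ) < k := by exact_mod_cast h
      have : 0 < c := by
        have := mul_nonneg hβ (sub_nonneg.2 hn')
        positivity
      exact (mul_eq_zero.1 hcp).resolve_left this.ne'
  have h := ev_eq_zero_of_ev_eul_nonpos (a := p * p) (by simp [hp0])
    (fun y _ => by rw [map_mul]; exact mul_self_nonneg _)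
    (fun y hy => by simp [Derivation.leibniz, heulp y hy]) hx
  have h' : ev x p = 0 := by simpa using h
  simpa [hp, sub_eq_zero] using h'

/-- Polynomials as smooth functions. -/
noncomputable def ofPoly : MvPolynomial (Fin n) ℝ →ₐ[ℝ] SmoothFun n := MvPolynomial.aeval coord

theorem ev_ofPoly (x : EuclideanSpace ℝ (Fin n)) (P : MvPolynomial (Fin n) ℝ) :
    ev x (ofPoly P) = MvPolynomial.eval x P := by
  have h : (ev x).comp ofPoly = MvPolynomial.aeval (x : Fin n → ℝ) :=
    MvPolynomial.algHom_ext fun i => by simp [ofPoly]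
  exact (DFunLike.congr_fun h P).trans (congrFun (MvPolynomial.aeval_eq_eval _) P)

theorem partialDeriv_ofPoly (i : Fin n) (P : MvPolynomial (Fin n) ℝ) :
    partialDeriv i (ofPoly P) = ofPoly (MvPolynomial.pderiv i P) := by
  induction P using MvPolynomial.induction_on with
  | C r => simp [ofPoly, ← MvPolynomial.algebraMap_eq]
  | add p q hp hq => simp only [map_add, hp, hq]
  | mul_X p j hp =>
    simp only [map_mul, Derivation.leibniz, hp, smul_eq_mul, map_add]
    simp only [ofPoly, MvPolynomial.aeval_X, partialDeriv_coord, MvPolynomial.pderiv_X,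
      Pi.single_apply, eq_comm (a := i)]
    split_ifs <;> simp

/-- The Laplacian on polynomials. -/
noncomputable def polyLaplace : MvPolynomial (Fin n) ℝ →ₗ[ℝ] MvPolynomial (Fin n) ℝ :=
  ∑ i, (MvPolynomial.pderiv i).toLinearMap ∘ₗ (MvPolynomial.pderiv i).toLinearMap

theorem polyLaplace_apply (P : MvPolynomial (Fin n) ℝ) :
    polyLaplace P = ∑ i, MvPolynomial.pderiv i (MvPolynomial.pderiv i P) := by
  simp [polyLaplace]

theorem laplace_ofPoly (P : MvPolynomial (Fin n) ℝ) :
    laplace (ofPoly P) = ofPoly (polyLaplace P) := by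
  simp [laplace_apply, polyLaplace_apply, partialDeriv_ofPoly]

theorem eul_ofPoly {P : MvPolynomial (Fin n) ℝ} {k : ℕ} (hP : P.IsHomogeneous k) :
    eul (ofPoly P) = (k : ℝ) • ofPoly P := by
  have h := congrArg ofPoly hP.sum_X_mul_pderiv
  rw [eul_apply]
  simp only [partialDeriv_ofPoly]
  simpa [ofPoly, Nat.cast_smul_eq_nsmul] using h

theorem eq_zero_of_ev_ofPoly_eq_zero {P : MvPolynomial (Fin n) ℝ}
    (h : ∀ x, ‖x‖ < 1 → ev x (ofPoly P) = 0) : P = 0 := by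
  have hnhds : {x : Fin n → ℝ | MvPolynomial.eval x P = 0} ∈ nhds 0 := by
    have hc : Continuous (WithLp.toLp 2 : (Fin n → ℝ) → EuclideanSpace ℝ (Fin n)) :=
      PiLp.continuous_toLp 2 _
    have hopen := (Metric.isOpen_ball (x := (0 : EuclideanSpace ℝ (Fin n))) (ε := 1)).preimage hc
    filter_upwards [hopen.mem_nhds (show (0 : Fin n → ℝ) ∈ _ by simp)] with x hx
    have := h (WithLp.toLp 2 x) (by simpa using hx)
    rwa [ev_ofPoly] at this
  obtain ⟨ε, hε, hball⟩ := Metric.mem_nhds_iff.1 hnhds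
  refine MvPolynomial.funext_set (fun _ => Metric.ball (0 : ℝ) ε)
    (fun _ => ?_) fun x hx => ?_
  · rw [Real.ball_eq_Ioo]
    exact Set.Ioo_infinite (by linarith)
  · rw [map_zero]
    exact hball (by rw [ball_pi _ hε]; simpa using hx)

theorem exists_poly_of_eul_eq (k : ℕ) {f : SmoothFun n}
    (hf : ∀ x, ‖x‖ < 1 → ev x (eul f) = k * ev x f) :
    ∃ P : MvPolynomial (Fin n) ℝ, P.IsHomogeneous k ∧ ∀ x, ‖x‖ < 1 → ev x f = ev x (ofPoly P) := by
  induction k generalizing f with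
  | zero =>
    refine ⟨MvPolynomial.C (ev 0 f), MvPolynomial.isHomogeneous_C _ _, fun x hx => ?_⟩
    have h := ev_eq_zero_of_ev_eul_nonpos
      (a := (f - algebraMap ℝ _ (ev 0 f)) * (f - algebraMap ℝ _ (ev 0 f))) (by simp)
      (fun y _ => by rw [map_mul]; exact mul_self_nonneg _)
      (fun y hy => by simp [Derivation.leibniz, hf y hy]) hx
    rw [map_mul, mul_self_eq_zero, map_sub, sub_eq_zero] at h
    rw [h, ev_ofPoly]
    simp
  | succ k ih =>
    have hd : ∀ i, ∀ x, ‖x‖ < 1 → ev x (eul (partialDeriv i f)) = k * ev x (partialDeriv i f) :=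
      fun i x hx => by
        have h := ev_dir_eq_zero (a := eul f - ((k + 1 : ℕ) : ℝ) • f)
          (fun y hy => by simp [hf y hy]) (EuclideanSpace.single i 1) hx
        change ev x (partialDeriv i _) = 0 at h
        rw [map_sub, partialDeriv_eul, Derivation.map_smul] at h
        simp only [map_sub, map_add, map_smul, smul_eq_mul] at h
        push_cast at h
        linarith
    choose P hP hPf using fun i => ih (hd i)
    refine ⟨MvPolynomial.C ((k + 1 : ℝ)⁻¹) * ∑ i, MvPolynomial.X i * P i, ?_, fun x hx => ?_⟩
    · rw [← zero_add (k + 1)]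
      refine (MvPolynomial.isHomogeneous_C _ _).mul (MvPolynomial.IsHomogeneous.sum _ _ _ ?_)
      intro i _
      rw [add_comm k 1]
      exact (MvPolynomial.isHomogeneous_X _ _).mul (hP i)
    · have h := hf x hx
      rw [eul_apply, map_sum] at h
      simp only [map_mul, hPf _ x hx] at h
      have hk : (k + 1 : ℝ) ≠ 0 := by positivity
      simp only [map_mul, map_sum]
      rw [show ev x (ofPoly (MvPolynomial.C (k + 1 : ℝ)⁻¹)) = (k + 1 : ℝ)⁻¹ by simp]
      have h' : ∀ i, ev x (ofPoly (MvPolynomial.X i)) = ev x (coord i) := fun i => by simp [ofPoly]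
      simp only [h']
      rw [h]
      push_cast
      field_simp

theorem eqOn_euler {f g : EuclideanSpace ℝ (Fin n) → ℝ} {W : Set (EuclideanSpace ℝ (Fin n))}
    (hW : IsOpen W) (h : Set.EqOn f g W) : Set.EqOn (euler f) (euler g) W := fun x hx => by
  rw [euler, euler, (h.eventuallyEq_of_mem (hW.mem_nhds hx)).fderiv_eq]

theorem eqOn_lap {f g : EuclideanSpace ℝ (Fin n) → ℝ} {W : Set (EuclideanSpace ℝ (Fin n))}
    (hW : IsOpen W) (h : Set.EqOn f g W) : Set.EqOn (lap f) (lap g) W := fun x hx => by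
  refine Finset.sum_congr rfl fun i _ => ?_
  have h' : Set.EqOn (fun y => fderiv ℝ f y (EuclideanSpace.single i 1))
      (fun y => fderiv ℝ g y (EuclideanSpace.single i 1)) W := fun y hy => by
    change fderiv ℝ f y _ = fderiv ℝ g y _
    rw [(h.eventuallyEq_of_mem (hW.mem_nhds hy)).fderiv_eq]
  rw [(h'.eventuallyEq_of_mem (hW.mem_nhds hx)).fderiv_eq]

/-- A function smooth near the closed unit ball agrees there with a globally smooth function. -/
theorem exists_smoothFun_eqOn {U : Set (EuclideanSpace ℝ (Fin n))}
    {v : EuclideanSpace ℝ (Fin n) → ℝ} (hU : IsOpen U)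
    (hBU : Metric.closedBall (0 : EuclideanSpace ℝ (Fin n)) 1 ⊆ U) (hv : ContDiffOn ℝ ∞ v U) :
    ∃ u : SmoothFun n, ∃ r > 1, Set.EqOn u.1 v (Metric.ball 0 r) := by
  obtain ⟨δ, hδ, hδU⟩ := (isCompact_closedBall (0 : EuclideanSpace ℝ (Fin n))
    1).exists_cthickening_subset_open hU hBU
  rw [cthickening_closedBall hδ.le zero_le_one] at hδU
  let χ : ContDiffBump (0 : EuclideanSpace ℝ (Fin n)) :=
    ⟨1 + δ / 2, δ + 1, by positivity, by linarith⟩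
  refine ⟨⟨fun x => χ x * v x, ?_⟩, 1 + δ / 2, by linarith, fun x hx => ?_⟩
  · change ContDiff ℝ ∞ fun x => χ x * v x
    refine contDiff_iff_contDiffAt.2 fun x => ?_
    by_cases hx : x ∈ tsupport χ
    · rw [χ.tsupport_eq] at hx
      exact χ.contDiffAt.mul (hv.contDiffAt (hU.mem_nhds (hδU (by simpa [χ, add_comm] using hx))))
    · refine (contDiffAt_const (c := (0 : ℝ))).congr_of_eventuallyEq ?_
      filter_upwards [notMem_tsupport_iff_eventuallyEq.1 hx] with y hy
      rw [hy, Pi.zero_apply, zero_mul]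
  · change χ x * v x = v x
    rw [χ.one_of_mem_closedBall (Metric.ball_subset_closedBall hx), one_mul]

/-- The harmonic homogeneous polynomials of degree `k`. -/
noncomputable def harmonicSubmodule (n k : ℕ) : Submodule ℝ (MvPolynomial (Fin n) ℝ) :=
  MvPolynomial.homogeneousSubmodule (Fin n) ℝ k ⊓ polyLaplace.ker

theorem mem_harmonicSubmodule {k : ℕ} {P : MvPolynomial (Fin n) ℝ} :
    P ∈ harmonicSubmodule n k ↔ P.IsHomogeneous k ∧ polyLaplace P = 0 := Iff.rfl

theorem lap_eval (P : MvPolynomial (Fin n) ℝ) (x : EuclideanSpace ℝ (Fin n)) :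
    lap (fun y : EuclideanSpace ℝ (Fin n) => MvPolynomial.eval y P) x =
      ev x (ofPoly (polyLaplace P)) := by
  have h : (ofPoly P).1 = fun y : EuclideanSpace ℝ (Fin n) => MvPolynomial.eval y P :=
    funext fun y => ev_ofPoly y P
  rw [← laplace_ofPoly, ← h, ← coe_laplace, ev_apply]

theorem finrank_homogeneousSubmodule (n k : ℕ) :
    Module.finrank ℝ (MvPolynomial.homogeneousSubmodule (Fin n) ℝ k) = n.multichoose k := by
  have h : (MvPolynomial.homogeneousSubmodule (Fin n) ℝ k) =
      MvPolynomial.restrictSupport ℝ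
        ((Finset.univ : Finset (Fin n)).finsuppAntidiag k : Set (Fin n →₀ ℕ)) := by
    rw [MvPolynomial.homogeneousSubmodule_eq_finsupp_supported]
    change MvPolynomial.restrictSupport ℝ _ = _
    congr 1
    ext d
    simp [Finsupp.degree_eq_sum]
  rw [h, Module.finrank_eq_card_basis (MvPolynomial.basisRestrictSupport ℝ _)]
  simp [Finset.card_finsuppAntidiag_nat_eq_multichoose]

theorem polyLaplace_isHomogeneous {k : ℕ} {P : MvPolynomial (Fin n) ℝ} (hP : P.IsHomogeneous k) :
    (polyLaplace P).IsHomogeneous (k - 1 - 1) := by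
  rw [polyLaplace_apply]
  exact MvPolynomial.IsHomogeneous.sum _ _ _ fun i _ => hP.pderiv.pderiv

theorem harmonicSubmodule_eq_of_le_one {k : ℕ} (hk : k ≤ 1) :
    harmonicSubmodule n k = MvPolynomial.homogeneousSubmodule (Fin n) ℝ k := by
  refine inf_eq_left.2 fun P hP => ?_
  rw [LinearMap.mem_ker, polyLaplace_apply]
  refine Finset.sum_eq_zero fun i _ => ?_
  have h : (MvPolynomial.pderiv i P).IsHomogeneous 0 := by
    have := ((MvPolynomial.mem_homogeneousSubmodule k P).1 hP).pderiv (i := i)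
    rwa [Nat.sub_eq_zero_of_le hk] at this
  rw [← MvPolynomial.totalDegree_zero_iff_isHomogeneous,
    MvPolynomial.totalDegree_eq_zero_iff_eq_C] at h
  rw [h, MvPolynomial.pderiv_C]

theorem finrank_harmonicSubmodule_two (hn : 0 < n) :
    2 * Module.finrank ℝ (harmonicSubmodule n 2) = n ^ 2 + n - 2 := by
  set H := MvPolynomial.homogeneousSubmodule (Fin n) ℝ 2 with hH
  have hfin : Module.Finite ℝ H := by
    rw [Module.Finite.iff_fg]; exact MvPolynomial.homogeneousSubmodule_fg _ _ _
  have hrn := LinearMap.finrank_range_add_finrank_ker (polyLaplace.domRestrict H)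
  have hker : Module.finrank ℝ (polyLaplace.domRestrict H).ker =
      Module.finrank ℝ (harmonicSubmodule n 2) := by
    rw [LinearMap.ker_domRestrict, ← Submodule.finrank_map_subtype_eq H,
      Submodule.map_comap_subtype H polyLaplace.ker, hH, harmonicSubmodule]
  have hrange : Module.finrank ℝ (polyLaplace.domRestrict H).range = 1 := by
    have h1 : (polyLaplace.domRestrict H).range =
        MvPolynomial.homogeneousSubmodule (Fin n) ℝ 0 := by
      refine le_antisymm ?_ fun P hP => ?_
      · rintro _ ⟨P, rfl⟩
        exact polyLaplace_isHomogeneous P.2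
      · rw [MvPolynomial.mem_homogeneousSubmodule,
          ← MvPolynomial.totalDegree_zero_iff_isHomogeneous,
          MvPolynomial.totalDegree_eq_zero_iff_eq_C] at hP
        set c := MvPolynomial.coeff 0 P
        let i : Fin n := ⟨0, hn⟩
        refine ⟨⟨MvPolynomial.C (c / 2) * MvPolynomial.X i ^ 2, ?_⟩, ?_⟩
        · rw [hH, MvPolynomial.mem_homogeneousSubmodule, ← zero_add 2]
          exact (MvPolynomial.isHomogeneous_C _ _).mul (MvPolynomial.isHomogeneous_X_pow _ _)
        · rw [LinearMap.domRestrict_apply, polyLaplace_apply, Finset.sum_eq_single i]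
          · rw [hP]
            simp only [MvPolynomial.pderiv_pow, MvPolynomial.pderiv_X_self,
              MvPolynomial.pderiv_mul]
            have h2 : (2 : MvPolynomial (Fin n) ℝ) = MvPolynomial.C 2 :=
              (map_ofNat MvPolynomial.C 2).symm
            simp [h2, ← MvPolynomial.C_mul]
          · intro j _ hj
            simp [MvPolynomial.pderiv_X_of_ne hj.symm]
          · simp
    rw [h1, finrank_homogeneousSubmodule, Nat.multichoose_zero_right]
  rw [hker, hrange, hH, finrank_homogeneousSubmodule, Nat.multichoose_eq] at hrn
  have h2 : 2 * (n + 2 - 1).choose 2 = n ^ 2 + n := by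
    rw [Nat.choose_two_right, Nat.mul_div_cancel' (Nat.even_mul_pred_self _).two_dvd]
    rw [show n + 2 - 1 = n + 1 by omega, Nat.add_sub_cancel]
    ring
  omega

/-- The map `w ↦ -2w + k(|x|² - 1)w` from polynomials to functions on a set. -/
noncomputable def wentzellMap (k : ℕ) (B : Set (EuclideanSpace ℝ (Fin n))) :
    MvPolynomial (Fin n) ℝ →ₗ[ℝ] (B → ℝ) where
  toFun P x := -2 * MvPolynomial.eval x.1 P + (k : ℝ) * (‖x.1‖ ^ 2 - 1) * MvPolynomial.eval x.1 P
  map_add' P Q := funext fun x => by simp; ring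
  map_smul' r P := funext fun x => by simp; ring

theorem wentzellMap_injective (k : ℕ) : Function.Injective
    (wentzellMap k (Metric.closedBall (0 : EuclideanSpace ℝ (Fin n)) 1)) := by
  rw [← LinearMap.ker_eq_bot, LinearMap.ker_eq_bot']
  intro P hP
  refine eq_zero_of_ev_ofPoly_eq_zero fun x hx => ?_
  have h : -2 * MvPolynomial.eval x P + (k : ℝ) * (‖x‖ ^ 2 - 1) * MvPolynomial.eval x P = 0 :=
    congrFun hP ⟨x, by simpa using hx.le⟩
  rw [ev_ofPoly]
  rw [← add_mul] at h
  refine (mul_eq_zero.1 h).resolve_left (ne_of_lt ?_)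
  have : (k : ℝ) * (‖x‖ ^ 2 - 1) ≤ 0 :=
    mul_nonpos_of_nonneg_of_nonpos k.cast_nonneg (by nlinarith [norm_nonneg x])
  linarith

theorem exists_poly_of_wentzell (hn : 2 ≤ n) {β : ℝ} (hβ : 0 ≤ β) (k : ℕ) {u : SmoothFun n}
    (hu : ∀ x, ‖x‖ < 1 → ev x (laplace (laplace u)) = 0)
    (hN : ∀ x, ‖x‖ = 1 → ev x (eul u) = 0)
    (hW : ∀ x, ‖x‖ = 1 → ev x (eul (laplace u)) +
      β * (ev x (laplace u) - ev x (eul (eul u))) +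
      ((k : ℝ) ^ 2 * (n + 2 * k) + β * k * (k + n - 2)) * ev x u = 0) :
    ∃ P ∈ harmonicSubmodule n k, ∀ x, ‖x‖ ≤ 1 →
      ev x u = -2 * MvPolynomial.eval x P + k * (‖x‖ ^ 2 - 1) * MvPolynomial.eval x P := by
  obtain ⟨f, hf, hcubic, huf⟩ := exists_harmonic_cubic_of_wentzell (by omega) hβ hu hN hW
  have hk : ∀ x, ‖x‖ < 1 → ev x (eul f) = ev x ((k : ℝ) • f) := fun x hx => by
    rw [ev_eul_eq_of_cubic hn hβ k hcubic hx, map_smul, smul_eq_mul]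
  obtain ⟨P, hP, hPf⟩ := exists_poly_of_eul_eq k (f := f) fun x hx => by
    rw [hk x hx, map_smul, smul_eq_mul]
  have hP0 : polyLaplace P = 0 := eq_zero_of_ev_ofPoly_eq_zero fun x hx => by
    rw [← laplace_ofPoly, ← ev_laplace_congr hPf hx, hf x hx]
  refine ⟨(-1 / 2 : ℝ) • P, Submodule.smul_mem _ _ (mem_harmonicSubmodule.2 ⟨hP, hP0⟩),
    fun x hx => ?_⟩
  rw [huf x hx, ev_congr_of_norm_le hk hx, map_smul, ev_congr_of_norm_le hPf hx, ev_ofPoly]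
  simp only [MvPolynomial.smul_eval, smul_eq_mul]
  ring

theorem wentzell_of_mem_harmonicSubmodule (β : ℝ) {k : ℕ} {P : MvPolynomial (Fin n) ℝ}
    (hP : P ∈ harmonicSubmodule n k) :
    ∃ u : SmoothFun n, laplace (laplace u) = 0 ∧ (∀ x, ‖x‖ = 1 → ev x (eul u) = 0) ∧
      (∀ x, ‖x‖ = 1 → ev x (eul (laplace u)) +
        β * (ev x (laplace u) - ev x (eul (eul u))) +
        ((k : ℝ) ^ 2 * (n + 2 * k) + β * k * (k + n - 2)) * ev x u = 0) ∧
      ∀ x, ev x u = -2 * MvPolynomial.eval x P + k * (‖x‖ ^ 2 - 1) * MvPolynomial.eval x P := by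
  obtain ⟨hP, hP0⟩ := mem_harmonicSubmodule.1 hP
  have he := eul_ofPoly hP
  have hl : laplace (ofPoly P) = 0 := by rw [laplace_ofPoly, hP0, map_zero]
  refine ⟨(-2 : ℝ) • ofPoly P + (k : ℝ) • (rho * ofPoly P), ?_, fun x hx => ?_, fun x hx => ?_,
    fun x => ?_⟩
  · simp [laplace_rho_mul, he, hl]
  · simp only [map_add, Derivation.map_smul, map_smul, Derivation.leibniz, he, eul_rho,
      smul_eq_mul, map_mul, ev_rho, hx, map_one]
    ring
  · simp only [map_add, Derivation.map_smul, map_smul, Derivation.leibniz, he, hl, eul_rho,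
      smul_eq_mul, map_mul, ev_rho, hx, map_one, laplace_rho_mul, map_zero, mul_zero,
      Derivation.map_one_eq_zero]
    ring
  · simp [ev_ofPoly, ev_rho, mul_assoc]

end SmoothFun

end Wentzell

open Wentzell Wentzell.SmoothFun

/-- Theorem 1.5(ii)-(iii): For `n ≥ 2`, `β ≥ 0`, `k ∈ ℕ` and
`ς_k = k²(n+2k) + βk(k+n-2)`, the set of smooth functions on the closed unit ball of `ℝⁿ`
(i.e. restrictions of functions smooth on an open neighborhood) satisfying `Δ²u = 0` in
`𝔹`, `ℰu = 0` on `∂𝔹`, and `ℰ(Δu) + β(Δu - ℰ²u) + ς_k·u = 0` on `∂𝔹` is exactly the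
vector space `E_k = {x ↦ -2w(x) + k(|x|²-1)w(x) : w ∈ D_k}` of restrictions to the closed
ball, whose dimension equals `μ_k = dim D_k`, with `μ_0 = 1`, `μ_1 = n`,
`μ_2 = (n² + n - 2)/2`. -/
theorem wentzell_eigenspace (n : ℕ) (hn : 2 ≤ n) (β : ℝ) (hβ : 0 ≤ β) (k : ℕ)
    (ς : ℝ)
    (hς : ς = (k : ℝ) ^ 2 * ((n : ℝ) + 2 * (k : ℝ)) +
      β * (k : ℝ) * ((k : ℝ) + (n : ℝ) - 2))
    (B : Set (EuclideanSpace ℝ (Fin n)))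
    (hB : B = Metric.closedBall (0 : EuclideanSpace ℝ (Fin n)) 1)
    (Dk : Set (MvPolynomial (Fin n) ℝ))
    (hDk : Dk = {P | P.IsHomogeneous k ∧
      ∀ x : EuclideanSpace ℝ (Fin n), lap (fun y => MvPolynomial.eval y P) x = 0})
    (S : Set (B → ℝ))
    (hS : S = {u | ∃ (U : Set (EuclideanSpace ℝ (Fin n)))
        (v : EuclideanSpace ℝ (Fin n) → ℝ),
      IsOpen U ∧ B ⊆ U ∧ ContDiffOn ℝ (⊤ : ℕ∞) v U ∧
      (∀ x ∈ Metric.ball (0 : EuclideanSpace ℝ (Fin n)) 1, lap (lap v) x = 0) ∧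
      (∀ y : EuclideanSpace ℝ (Fin n), ‖y‖ = 1 → euler v y = 0) ∧
      (∀ y : EuclideanSpace ℝ (Fin n), ‖y‖ = 1 →
        euler (lap v) y + β * (lap v y - euler (euler v) y) + ς * v y = 0) ∧
      u = fun x : B => v x.1})
    (Ek : Set (B → ℝ))
    (hEk : Ek = {u | ∃ P ∈ Dk, u = fun x : B =>
      -2 * MvPolynomial.eval x.1 P + (k : ℝ) * (‖x.1‖ ^ 2 - 1) * MvPolynomial.eval x.1 P}) :
    S = Ek ∧
    Module.finrank ℝ (Submodule.span ℝ S) = Module.finrank ℝ (Submodule.span ℝ Dk) ∧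
    (k = 0 → Module.finrank ℝ (Submodule.span ℝ Dk) = 1) ∧
    (k = 1 → Module.finrank ℝ (Submodule.span ℝ Dk) = n) ∧
    (k = 2 → 2 * Module.finrank ℝ (Submodule.span ℝ Dk) = n ^ 2 + n - 2) := by
  subst hB hς
  have hDk' : Dk = (harmonicSubmodule n k : Set (MvPolynomial (Fin n) ℝ)) := by
    rw [hDk]
    ext P
    simp only [Set.mem_ofPred_eq, SetLike.mem_coe, mem_harmonicSubmodule, lap_eval]
    refine and_congr_right fun _ => ⟨fun h => ?_, fun h x => by rw [h, map_zero, map_zero]⟩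
    exact eq_zero_of_ev_ofPoly_eq_zero fun x _ => h x
  have hEk' : Ek = ((harmonicSubmodule n k).map
      (wentzellMap k (Metric.closedBall (0 : EuclideanSpace ℝ (Fin n)) 1)) : Set _) := by
    rw [hEk, hDk']
    ext u
    exact exists_congr fun P => and_congr_right fun _ => eq_comm
  have hSE : S = Ek := by
    rw [hS, hEk, hDk']
    ext w
    constructor
    · rintro ⟨U, v, hU, hBU, hv, h₁, h₂, h₃, rfl⟩
      obtain ⟨u, r, hr, huv⟩ := exists_smoothFun_eqOn hU hBU hv
      have hmem : ∀ x : EuclideanSpace ℝ (Fin n), ‖x‖ ≤ 1 → x ∈ Metric.ball 0 r :=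
        fun x hx => by simpa using hx.trans_lt hr
      have hl := eqOn_lap Metric.isOpen_ball huv
      have hll := eqOn_lap Metric.isOpen_ball hl
      have he := eqOn_euler Metric.isOpen_ball huv
      have hee := eqOn_euler Metric.isOpen_ball he
      have hel := eqOn_euler Metric.isOpen_ball hl
      obtain ⟨P, hP, hPu⟩ := exists_poly_of_wentzell hn hβ k (u := u)
        (fun x hx => by
          rw [ev_apply, coe_laplace, coe_laplace, hll (hmem x hx.le)]
          exact h₁ x (by simpa using hx))
        (fun x hx => by
          rw [ev_apply, coe_eul, he (hmem x hx.le)]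
          exact h₂ x hx)
        (fun x hx => by
          simp only [ev_apply, coe_eul, coe_laplace]
          rw [hel (hmem x hx.le), hl (hmem x hx.le), hee (hmem x hx.le), huv (hmem x hx.le)]
          exact h₃ x hx)
      refine ⟨P, hP, funext fun x => ?_⟩
      have hx : ‖x.1‖ ≤ 1 := mem_closedBall_zero_iff.1 x.2
      rw [← hPu x.1 hx, ev_apply, huv (hmem _ hx)]
    · rintro ⟨P, hP, rfl⟩
      obtain ⟨u, h₁, h₂, h₃, hu⟩ := wentzell_of_mem_harmonicSubmodule β hP
      refine ⟨Set.univ, u.1, isOpen_univ, Set.subset_univ _, (contDiff_coe u).contDiffOn,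
        fun x _ => ?_, fun x hx => ?_, fun x hx => ?_, funext fun x => (hu x.1).symm⟩
      · rw [← coe_laplace, ← coe_laplace, h₁]; rfl
      · rw [← coe_eul]; exact h₂ x hx
      · simp only [← coe_laplace, ← coe_eul]; exact h₃ x hx
  refine ⟨hSE, ?_, ?_, ?_, ?_⟩
  · rw [hSE, hEk', hDk', Submodule.span_eq, Submodule.span_eq]
    exact (Submodule.equivMapOfInjective _ (wentzellMap_injective k) _).finrank_eq.symm
  · rintro rfl
    rw [hDk', Submodule.span_eq, harmonicSubmodule_eq_of_le_one zero_le_one,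
      finrank_homogeneousSubmodule, Nat.multichoose_zero_right]
  · rintro rfl
    rw [hDk', Submodule.span_eq, harmonicSubmodule_eq_of_le_one le_rfl,
      finrank_homogeneousSubmodule, Nat.multichoose_one_right]
  · rintro rfl
    rw [hDk', Submodule.span_eq]
    exact finrank_harmonicSubmodule_two (by omega)
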